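/- arXiv:0802.3896 — 11 statements merged into one kernel-verified Lean document; each statement's English description precedes it below -/
import Mathlib

section
/- Let R1, R2 ∈ ℝ³ be distinct vectors (R1 ≠ R2) with ‖R1‖ ≤ 1 and ‖R2‖ ≤ 1. Then ‖R1 − R2‖² > ‖R1 × R2‖², where × denotes the cross product and ‖·‖ the Euclidean norm. -/
noncomputable section

open Real

/-- Euclidean dot product on ℝ³ (vectors as `Fin 3 → ℝ`). -/
def dot3 (v w : Fin 3 → ℝ) : ℝ := v 0 * w 0 + v 1 * w 1 + v 2 * w 2

/-- Cross product on ℝ³. -/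
def cross3 (v w : Fin 3 → ℝ) : Fin 3 → ℝ :=
  ![v 1 * w 2 - v 2 * w 1, v 2 * w 0 - v 0 * w 2, v 0 * w 1 - v 1 * w 0]

/-- Euclidean norm on ℝ³. -/
def norm3 (v : Fin 3 → ℝ) : ℝ := Real.sqrt (dot3 v v)

/-- `T = Σ_{i,j∈{1,2}} (1 − Ri·Rj)(Rbi·Rbj)`. -/
def Tq (R1 R2 Rb1 Rb2 : Fin 3 → ℝ) : ℝ :=
  (1 - dot3 R1 R1) * dot3 Rb1 Rb1 + (1 - dot3 R1 R2) * dot3 Rb1 Rb2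
    + (1 - dot3 R2 R1) * dot3 Rb2 Rb1 + (1 - dot3 R2 R2) * dot3 Rb2 Rb2

/-- `S = √(T² + 4·Rbx²·(Rm² − Rx²))`. -/
def Sq (R1 R2 Rb1 Rb2 : Fin 3 → ℝ) : ℝ :=
  Real.sqrt ((Tq R1 R2 Rb1 Rb2) ^ 2
    + 4 * (norm3 (cross3 Rb1 Rb2)) ^ 2
      * ((norm3 (R1 - R2)) ^ 2 - (norm3 (cross3 R1 R2)) ^ 2))

/-- Indicator function `Ω = S + T − 2·Rbx·Rx`. -/
def Omega (R1 R2 Rb1 Rb2 : Fin 3 → ℝ) : ℝ :=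
  Sq R1 R2 Rb1 Rb2 + Tq R1 R2 Rb1 Rb2
    - 2 * norm3 (cross3 Rb1 Rb2) * norm3 (cross3 R1 R2)

/-- `Ξ = (R1·(R1−R2))(Rb1·(Rb1+Rb2)) + (R2·(R1−R2))(Rb2·(Rb1+Rb2))`. -/
def Xi (R1 R2 Rb1 Rb2 : Fin 3 → ℝ) : ℝ :=
  dot3 R1 (R1 - R2) * dot3 Rb1 (Rb1 + Rb2) + dot3 R2 (R1 - R2) * dot3 Rb2 (Rb1 + Rb2)

/-- `ξ = Rx·Rbp² + Rbx·Rm²`. -/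
def xiq (R1 R2 Rb1 Rb2 : Fin 3 → ℝ) : ℝ :=
  norm3 (cross3 R1 R2) * (norm3 (Rb1 + Rb2)) ^ 2
    + norm3 (cross3 Rb1 Rb2) * (norm3 (R1 - R2)) ^ 2

/-- `Γ_b² = Rbp² − T + 2·Rx·Rbx`. -/
def Gb2 (R1 R2 Rb1 Rb2 : Fin 3 → ℝ) : ℝ :=
  (norm3 (Rb1 + Rb2)) ^ 2 - Tq R1 R2 Rb1 Rb2
    + 2 * norm3 (cross3 R1 R2) * norm3 (cross3 Rb1 Rb2)

theorem dot3_self_nonneg (v : Fin 3 → ℝ) : 0 ≤ dot3 v v := by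
  unfold dot3
  nlinarith [mul_self_nonneg (v 0), mul_self_nonneg (v 1), mul_self_nonneg (v 2)]

theorem norm3_sq (v : Fin 3 → ℝ) : norm3 v ^ 2 = dot3 v v :=
  Real.sq_sqrt (dot3_self_nonneg v)

theorem dot3_self_pos {v : Fin 3 → ℝ} (hv : v ≠ 0) : 0 < dot3 v v := by
  refine (dot3_self_nonneg v).lt_of_ne' fun h => hv ?_
  unfold dot3 at h
  have h0 := mul_self_nonneg (v 0)
  have h1 := mul_self_nonneg (v 1)
  have h2 := mul_self_nonneg (v 2)
  ext i
  fin_cases i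
  · exact mul_self_eq_zero.mp (show v 0 * v 0 = 0 by linarith)
  · exact mul_self_eq_zero.mp (show v 1 * v 1 = 0 by linarith)
  · exact mul_self_eq_zero.mp (show v 2 * v 2 = 0 by linarith)

/-- Lagrange's identity applied to `v × w = (v - w) × v`. -/
theorem dot3_cross3_self (v w : Fin 3 → ℝ) :
    dot3 (cross3 v w) (cross3 v w)
      = dot3 v v * dot3 (v - w) (v - w) - dot3 v (v - w) ^ 2 := by
  simp [dot3, cross3]
  ring

theorem dot3_self_eq_sub (v w : Fin 3 → ℝ) :
    dot3 w w = dot3 v v - 2 * dot3 v (v - w) + dot3 (v - w) (v - w) := by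
  simp only [dot3, Pi.sub_apply]
  ring

/-- for distinct Bloch vectors `R1 ≠ R2` with `‖R1‖ ≤ 1`, `‖R2‖ ≤ 1`,
one has `‖R1 − R2‖² > ‖R1 × R2‖²`. -/
theorem stmt_0 (R1 R2 : Fin 3 → ℝ) (hne : R1 ≠ R2)
    (h1 : norm3 R1 ≤ 1) (h2 : norm3 R2 ≤ 1) :
    (norm3 (R1 - R2)) ^ 2 > (norm3 (cross3 R1 R2)) ^ 2 := by
  rw [gt_iff_lt, norm3_sq, norm3_sq, dot3_cross3_self]
  have hD : 0 < dot3 (R1 - R2) (R1 - R2) := dot3_self_pos (sub_ne_zero.mpr hne)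
  have ha : dot3 R1 R1 ≤ 1 := Real.sqrt_le_one.mp h1
  have hb : dot3 R2 R2 ≤ 1 := Real.sqrt_le_one.mp h2
  rw [dot3_self_eq_sub R1 R2] at hb
  by_cases hp : dot3 R1 (R1 - R2) = 0
  · rw [hp] at hb ⊢
    nlinarith
  · have := sq_pos_of_ne_zero hp
    nlinarith
end
end

section
/- For all vectors R1, R2, Rb1, Rb2 ∈ ℝ³, the identity Ξ² + ξ² = Rm² · Rbp² · Gb2 holds, where Ξ = (R1·(R1−R2))(Rb1·(Rb1+Rb2)) + (R2·(R1−R2))(Rb2·(Rb1+Rb2)), ξ = Rx·Rbp² + Rbx·Rm², and Gb2 = Rbp² − T + 2·Rx·Rbx. -/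
noncomputable section

open Real

theorem dot3_comm (v w : Fin 3 → ℝ) : dot3 v w = dot3 w v := by
  unfold dot3
  ring

theorem dot3_add (u v w : Fin 3 → ℝ) : dot3 u (v + w) = dot3 u v + dot3 u w := by
  simp only [dot3, Pi.add_apply]
  ring

theorem dot3_sub (u v w : Fin 3 → ℝ) : dot3 u (v - w) = dot3 u v - dot3 u w := by
  simp only [dot3, Pi.sub_apply]
  ring

theorem norm3_add_sq (v w : Fin 3 → ℝ) :
    norm3 (v + w) ^ 2 = dot3 v v + 2 * dot3 v w + dot3 w w := by
  rw [norm3_sq]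
  simp only [dot3, Pi.add_apply]
  ring

theorem norm3_sub_sq (v w : Fin 3 → ℝ) :
    norm3 (v - w) ^ 2 = dot3 v v - 2 * dot3 v w + dot3 w w := by
  rw [norm3_sq]
  simp only [dot3, Pi.sub_apply]
  ring

/-- Lagrange's identity. -/
theorem norm3_cross3_sq (v w : Fin 3 → ℝ) :
    norm3 (cross3 v w) ^ 2 = dot3 v v * dot3 w w - dot3 v w ^ 2 := by
  rw [norm3_sq]
  simp [dot3, cross3]
  ring

/-- the identity `Ξ² + ξ² = Rm² · Rbp² · Γ_b²` holds for all vectors. -/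
theorem stmt_3 (R1 R2 Rb1 Rb2 : Fin 3 → ℝ) :
    (Xi R1 R2 Rb1 Rb2) ^ 2 + (xiq R1 R2 Rb1 Rb2) ^ 2 =
      (norm3 (R1 - R2)) ^ 2 * (norm3 (Rb1 + Rb2)) ^ 2 * Gb2 R1 R2 Rb1 Rb2 := by
  simp only [Xi, xiq, Gb2, Tq, norm3_add_sq, norm3_sub_sq, dot3_add, dot3_sub,
    dot3_comm R2 R1, dot3_comm Rb2 Rb1]
  linear_combination
    (dot3 Rb1 Rb1 + 2 * dot3 Rb1 Rb2 + dot3 Rb2 Rb2) ^ 2 * norm3_cross3_sq R1 R2 +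
      (dot3 R1 R1 - 2 * dot3 R1 R2 + dot3 R2 R2) ^ 2 * norm3_cross3_sq Rb1 Rb2
end
end

section
/- Assume R1 ≠ R2, ‖R1‖ ≤ 1, ‖R2‖ ≤ 1, and that Rb1 and Rb2 are not both the zero vector. Then S + Rbp² > 0. -/
noncomputable section

open Real

theorem dot3_self_eq_zero {v : Fin 3 → ℝ} : dot3 v v = 0 ↔ v = 0 := by
  refine ⟨fun h => ?_, fun h => by simp [h, dot3]⟩
  unfold dot3 at h
  ext i
  fin_cases i <;> simp <;> nlinarith [mul_self_nonneg (v 0), mul_self_nonneg (v 1),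
    mul_self_nonneg (v 2)]

theorem cross3_neg_self (v : Fin 3 → ℝ) : cross3 v (-v) = 0 := by
  ext i
  fin_cases i <;> simp [cross3] <;> ring

theorem Tq_neg_self (R1 R2 v : Fin 3 → ℝ) :
    Tq R1 R2 v (-v) = -(dot3 v v * dot3 (R1 - R2) (R1 - R2)) := by
  simp only [Tq, dot3, Pi.neg_apply, Pi.sub_apply]
  ring

theorem Sq_neg_self (R1 R2 v : Fin 3 → ℝ) :
    Sq R1 R2 v (-v) = dot3 v v * dot3 (R1 - R2) (R1 - R2) := by
  have h : norm3 (cross3 v (-v)) ^ 2 = 0 := by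
    rw [norm3_sq, cross3_neg_self, dot3_self_eq_zero]
  rw [Sq, h, mul_zero, zero_mul, add_zero, Tq_neg_self, neg_sq,
    Real.sqrt_sq (mul_nonneg (dot3_self_nonneg _) (dot3_self_nonneg _))]

/-- if `R1 ≠ R2`, `‖R1‖ ≤ 1`, `‖R2‖ ≤ 1` and the targets are not both the
zero vector, then `S + Rbp² > 0`. -/
theorem stmt_5 (R1 R2 Rb1 Rb2 : Fin 3 → ℝ) (hne : R1 ≠ R2)
    (h1 : norm3 R1 ≤ 1) (h2 : norm3 R2 ≤ 1)
    (hb : ¬(Rb1 = 0 ∧ Rb2 = 0)) :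
    0 < Sq R1 R2 Rb1 Rb2 + (norm3 (Rb1 + Rb2)) ^ 2 := by
  rw [norm3_sq]
  by_cases hsum : Rb1 + Rb2 = 0
  · obtain rfl : Rb2 = -Rb1 := (neg_eq_of_add_eq_zero_right hsum).symm
    have hv : Rb1 ≠ 0 := fun h => hb ⟨h, by simp [h]⟩
    have hpos {v : Fin 3 → ℝ} (h : v ≠ 0) : 0 < dot3 v v :=
      (dot3_self_nonneg v).lt_of_ne' (mt dot3_self_eq_zero.1 h)
    rw [Sq_neg_self]
    exact add_pos_of_pos_of_nonneg (mul_pos (hpos hv) (hpos (sub_ne_zero.2 hne)))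
      (dot3_self_nonneg _)
  · exact add_pos_of_nonneg_of_pos (Real.sqrt_nonneg _)
      ((dot3_self_nonneg _).lt_of_ne' (mt dot3_self_eq_zero.1 hsum))
end
end

section
/- Assume R1 ≠ R2, ‖R1‖ ≤ 1, ‖R2‖ ≤ 1, and S + T > 0. Then (Rm² − Rx²)·(Rbp² + 2·Rm²·Rbx²/(S+T))² ≥ Ξ², where Ξ = (R1·(R1−R2))(Rb1·(Rb1+Rb2)) + (R2·(R1−R2))(Rb2·(Rb1+Rb2)). (The quantity Rbp² + 2·Rm²·Rbx²/(S+T) equals Γ_a², so this states (Rm² − Rx²)·Γ_a⁴ − Ξ² ≥ 0, the non-negativity of the relevant coefficient in the characteristic polynomial of the dual certificate for procedure A.) -/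
noncomputable section

open Real

theorem dot3_self_le_one {v : Fin 3 → ℝ} (h : norm3 v ≤ 1) : dot3 v v ≤ 1 := by
  have h₀ : 0 ≤ norm3 v := Real.sqrt_nonneg _
  rw [← norm3_sq]
  nlinarith

/-- `Rx² ≤ Rm²` for vectors in the unit ball. -/
theorem dot3_cross3_self_le_dot3_sub_self {v w : Fin 3 → ℝ}
    (hv : dot3 v v ≤ 1) (hw : dot3 w w ≤ 1) :
    dot3 (cross3 v w) (cross3 v w) ≤ dot3 (v - w) (v - w) := by
  have hsub : dot3 (v - w) (v - w) = dot3 v v - 2 * dot3 v w + dot3 w w := by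
    simp only [dot3, Pi.sub_apply]; ring
  have hcross : dot3 (cross3 v w) (cross3 v w) = dot3 v v * dot3 w w - dot3 v w ^ 2 := by
    simp [dot3, cross3]; ring
  have h := dot3_self_nonneg (v - w)
  rw [hcross, hsub]
  rw [hsub] at h
  nlinarith [sq_nonneg (dot3 v v - dot3 w w),
    mul_nonneg h (by linarith : 0 ≤ 2 * (1 - dot3 v w) + (1 - dot3 v v) + (1 - dot3 w w))]

/-- The scalar inequality: `V` is the squared norm of a vector with
`P * V - Ξ ^ 2 = M ^ 2 * Y`. -/
theorem sq_le_mul_sq_of_gram {M D P Y T S V Ξ : ℝ} (hM : 0 ≤ M) (hP : 0 ≤ P)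
    (hY : 0 ≤ Y) (hV : 0 ≤ V) (hS : S ^ 2 = T ^ 2 + 4 * Y * D) (hST : 0 < S + T)
    (hT : M * T = D * P - V) (hΞ : Ξ ^ 2 = P * V - M ^ 2 * Y) :
    Ξ ^ 2 ≤ D * (P + 2 * M * Y / (S + T)) ^ 2 := by
  obtain ⟨u, hu⟩ : ∃ u, u = 2 * Y / (S + T) := ⟨_, rfl⟩
  have hu₀ : 0 ≤ u := hu ▸ by positivity
  have huY : u * (S + T) = 2 * Y := by rw [hu]; field_simp
  have hroot : D * u ^ 2 + T * u - Y = 0 := by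
    rw [hu]
    field_simp
    linear_combination (-Y) * hS
  have hG : 2 * M * Y / (S + T) = M * u := by rw [hu]; ring
  rw [hG]
  have hDu : D * u * (P + M * u) = M * Y + V * u := by
    linear_combination M * hroot - u * hT
  rcases hu₀.eq_or_lt with h | h
  · subst h
    have hY₀ : Y = 0 := by linarith
    subst hY₀
    have hT₀ : 0 ≤ T := by
      by_contra! hneg
      nlinarith
    nlinarith [mul_nonneg (mul_nonneg hM hT₀) hP]
  · refine le_of_mul_le_mul_left ?_ h
    have key : u * (D * (P + M * u) ^ 2) = (M * Y + V * u) * (P + M * u) := by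
      rw [← hDu]; ring
    rw [key, hΞ]
    have e₁ : 0 ≤ M * Y * P := by positivity
    have e₂ : 0 ≤ M ^ 2 * Y * u := by positivity
    have e₃ : 0 ≤ M * V * u ^ 2 := by positivity
    nlinarith

/-- if `R1 ≠ R2`, `‖R1‖ ≤ 1`, `‖R2‖ ≤ 1` and `S + T > 0`, then
`(Rm² − Rx²)·(Rbp² + 2·Rm²·Rbx²/(S+T))² ≥ Ξ²`, i.e. `(Rm² − Rx²)·Γ_a⁴ − Ξ² ≥ 0`. -/
theorem stmt_6 (R1 R2 Rb1 Rb2 : Fin 3 → ℝ) (hne : R1 ≠ R2)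
    (h1 : norm3 R1 ≤ 1) (h2 : norm3 R2 ≤ 1)
    (hST : 0 < Sq R1 R2 Rb1 Rb2 + Tq R1 R2 Rb1 Rb2) :
    (Xi R1 R2 Rb1 Rb2) ^ 2 ≤
      ((norm3 (R1 - R2)) ^ 2 - (norm3 (cross3 R1 R2)) ^ 2) *
        ((norm3 (Rb1 + Rb2)) ^ 2
          + 2 * (norm3 (R1 - R2)) ^ 2 * (norm3 (cross3 Rb1 Rb2)) ^ 2 /
            (Sq R1 R2 Rb1 Rb2 + Tq R1 R2 Rb1 Rb2)) ^ 2 := by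
  simp only [norm3_sq]
  have hD := dot3_cross3_self_le_dot3_sub_self (dot3_self_le_one h1) (dot3_self_le_one h2)
  have hY := dot3_self_nonneg (cross3 Rb1 Rb2)
  refine sq_le_mul_sq_of_gram (dot3_self_nonneg _) (dot3_self_nonneg _) hY
    (dot3_self_nonneg (dot3 R1 (R1 - R2) • Rb1 + dot3 R2 (R1 - R2) • Rb2)) ?_ hST ?_ ?_
  · unfold Sq
    simp only [norm3_sq]
    refine Real.sq_sqrt ?_
    have := mul_nonneg hY (sub_nonneg.2 hD)
    nlinarith [sq_nonneg (Tq R1 R2 Rb1 Rb2)]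
  · simp [Tq, dot3, cross3]
    ring
  · simp [Xi, dot3, cross3]
    ring
end
end

section
/- Assume R1 ≠ R2, ‖R1‖ ≤ 1, ‖R2‖ ≤ 1, and Ω ≤ 0. Then Rx·Gb2 ≥ ξ, where Gb2 = Rbp² − T + 2·Rx·Rbx and ξ = Rx·Rbp² + Rbx·Rm². (This is the inequality Rx·Γ_b² − ξ ≥ 0 needed for the non-positivity of the constant coefficient of the characteristic polynomial of the dual certificate for procedure B.) -/
noncomputable section

open Real

/-- if `R1 ≠ R2`, `‖R1‖ ≤ 1`, `‖R2‖ ≤ 1` and `Ω ≤ 0`, then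
`Rx·Γ_b² ≥ ξ`. -/
theorem stmt_7 (R1 R2 Rb1 Rb2 : Fin 3 → ℝ) (hne : R1 ≠ R2)
    (h1 : norm3 R1 ≤ 1) (h2 : norm3 R2 ≤ 1)
    (hOmega : Omega R1 R2 Rb1 Rb2 ≤ 0) :
    xiq R1 R2 Rb1 Rb2 ≤ norm3 (cross3 R1 R2) * Gb2 R1 R2 Rb1 Rb2 := by
  unfold Omega Sq at hOmega
  unfold xiq Gb2
  have hx : 0 ≤ norm3 (cross3 R1 R2) := Real.sqrt_nonneg _
  have hb : 0 ≤ norm3 (cross3 Rb1 Rb2) := Real.sqrt_nonneg _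
  generalize norm3 (cross3 R1 R2) = x at *
  generalize norm3 (cross3 Rb1 Rb2) = b at *
  generalize norm3 (R1 - R2) = m at *
  generalize norm3 (Rb1 + Rb2) = p at *
  generalize Tq R1 R2 Rb1 Rb2 = T at *
  have hS : √(T ^ 2 + 4 * b ^ 2 * (m ^ 2 - x ^ 2)) ≤ 2 * b * x - T := by linarith
  obtain ⟨hnn, hsq⟩ := Real.sqrt_le_iff.mp hS
  rcases hb.eq_or_lt with rfl | hpos
  · nlinarith [mul_nonneg hx hnn]
  · have hmul : b * (b * m ^ 2) ≤ b * (2 * b * x ^ 2 - x * T) := by linarith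
    have := le_of_mul_le_mul_left hmul hpos
    linarith
end
end

section
/- For all vectors R1, R2, Rb1, Rb2 ∈ ℝ³, the identity Rm²·Gb2·ξ − Rx·(ξ² + Ξ²) = Rm⁴·Rbx·Gb2 holds, where Ξ = (R1·(R1−R2))(Rb1·(Rb1+Rb2)) + (R2·(R1−R2))(Rb2·(Rb1+Rb2)), ξ = Rx·Rbp² + Rbx·Rm², and Gb2 = Rbp² − T + 2·Rx·Rbx. -/
noncomputable section

open Real

/-- the identity `Rm²·Γ_b²·ξ − Rx·(ξ² + Ξ²) = Rm⁴·Rbx·Γ_b²` holds for all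
vectors. -/
theorem stmt_8 (R1 R2 Rb1 Rb2 : Fin 3 → ℝ) :
    (norm3 (R1 - R2)) ^ 2 * Gb2 R1 R2 Rb1 Rb2 * xiq R1 R2 Rb1 Rb2
      - norm3 (cross3 R1 R2) * ((xiq R1 R2 Rb1 Rb2) ^ 2 + (Xi R1 R2 Rb1 Rb2) ^ 2)
      = (norm3 (R1 - R2)) ^ 4 * norm3 (cross3 Rb1 Rb2) * Gb2 R1 R2 Rb1 Rb2 := by
  have hm : norm3 (R1 - R2) ^ 4 = (norm3 (R1 - R2) ^ 2) ^ 2 := by ring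
  have hx := norm3_cross3_sq R1 R2
  have hy := norm3_cross3_sq Rb1 Rb2
  simp only [hm, Gb2, xiq, Xi, Tq, norm3_sub_sq, norm3_add_sq, dot3_add, dot3_sub,
    dot3_comm R2 R1, dot3_comm Rb2 Rb1]
  set x := norm3 (cross3 R1 R2)
  set y := norm3 (cross3 Rb1 Rb2)
  linear_combination
    (-x * (dot3 Rb1 Rb1 + 2 * dot3 Rb1 Rb2 + dot3 Rb2 Rb2) ^ 2) * hx
      - x * (dot3 R1 R1 - 2 * dot3 R1 R2 + dot3 R2 R2) ^ 2 * hy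
end
end

section
/- Let θ, θb ∈ (0, π/2] and p1, p2 ∈ (0, 1) with p1 + p2 = 1. Set R1 = (sin θ, 0, cos θ), R2 = (−sin θ, 0, cos θ), Rb1 = p1·(sin θb, 0, cos θb), and Rb2 = p2·(−sin θb, 0, cos θb) (pure source states separated by Bloch angle 2θ and pure target states separated by Bloch angle 2θb, weighted by the priorities p1, p2). Then Ω = 8·p1·p2·sin θ·cos θb·sin(θ − θb). -/
noncomputable section

open Real

theorem norm3_eq_of_dot3_self_eq_sq {v : Fin 3 → ℝ} {r : ℝ} (hr : 0 ≤ r)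
    (h : dot3 v v = r ^ 2) : norm3 v = r := by
  rw [norm3, h, Real.sqrt_sq hr]

/-- The cross product of two weighted vectors placed symmetrically about the third axis. -/
theorem norm3_cross3_symmetric {p q s c : ℝ} (hp : 0 ≤ p) (hq : 0 ≤ q) (hs : 0 ≤ s)
    (hc : 0 ≤ c) :
    norm3 (cross3 (p • ![s, 0, c]) (q • ![-s, 0, c])) = 2 * (p * q) * s * c := by
  refine norm3_eq_of_dot3_self_eq_sq (by positivity) ?_
  simp [dot3, cross3]
  ring

/-- for pure sources separated by Bloch angle `2θ` and pure targets
separated by Bloch angle `2θb` with priorities `p1, p2`, the indicator function is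
`Ω = 8·p1·p2·sin θ·cos θb·sin(θ − θb)`. -/
theorem stmt_13 (θ θb p1 p2 : ℝ)
    (hθ : θ ∈ Set.Ioc 0 (π / 2)) (hθb : θb ∈ Set.Ioc 0 (π / 2))
    (hp1 : p1 ∈ Set.Ioo (0 : ℝ) 1) (hp2 : p2 ∈ Set.Ioo (0 : ℝ) 1)
    (hp : p1 + p2 = 1) :
    Omega ![sin θ, 0, cos θ] ![-sin θ, 0, cos θ]
        (p1 • ![sin θb, 0, cos θb]) (p2 • ![-sin θb, 0, cos θb])
      = 8 * p1 * p2 * sin θ * cos θb * sin (θ - θb) := by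
  have hs : 0 ≤ sin θ := sin_nonneg_of_nonneg_of_le_pi hθ.1.le (by linarith [hθ.2, pi_pos])
  have hc : 0 ≤ cos θ := cos_nonneg_of_neg_pi_div_two_le_of_le (by linarith [hθ.1, pi_pos]) hθ.2
  have hsb : 0 ≤ sin θb :=
    sin_nonneg_of_nonneg_of_le_pi hθb.1.le (by linarith [hθb.2, pi_pos])
  have hcb : 0 ≤ cos θb :=
    cos_nonneg_of_neg_pi_div_two_le_of_le (by linarith [hθb.1, pi_pos]) hθb.2
  have hp1' : 0 ≤ p1 := hp1.1.le
  have hp2' : 0 ≤ p2 := hp2.1.le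
  have hRx : norm3 (cross3 ![sin θ, 0, cos θ] ![-sin θ, 0, cos θ]) = 2 * sin θ * cos θ := by
    simpa using norm3_cross3_symmetric zero_le_one zero_le_one hs hc
  have hRbx := norm3_cross3_symmetric hp1' hp2' hsb hcb
  have hRm : norm3 (![sin θ, 0, cos θ] - ![-sin θ, 0, cos θ]) ^ 2 = 4 * sin θ ^ 2 := by
    rw [norm3_sq]
    simp [dot3]
    ring
  have e := sin_sq_add_cos_sq θ
  have eb := sin_sq_add_cos_sq θb
  have hT : Tq ![sin θ, 0, cos θ] ![-sin θ, 0, cos θ]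
      (p1 • ![sin θb, 0, cos θb]) (p2 • ![-sin θb, 0, cos θb])
      = 4 * (p1 * p2) * sin θ ^ 2 * (cos θb ^ 2 - sin θb ^ 2) := by
    simp [Tq, dot3]
    grind
  have hS : Sq ![sin θ, 0, cos θ] ![-sin θ, 0, cos θ]
      (p1 • ![sin θb, 0, cos θb]) (p2 • ![-sin θb, 0, cos θb])
      = 4 * (p1 * p2) * sin θ ^ 2 := by
    rw [Sq, hT, hRx, hRbx, hRm]
    have key : (4 * (p1 * p2) * sin θ ^ 2 * (cos θb ^ 2 - sin θb ^ 2)) ^ 2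
        + 4 * (2 * (p1 * p2) * sin θb * cos θb) ^ 2
          * (4 * sin θ ^ 2 - (2 * sin θ * cos θ) ^ 2)
        = (4 * (p1 * p2) * sin θ ^ 2) ^ 2 := by
      rw [mul_pow (2 * sin θ), cos_sq' θ, mul_pow _ (cos θb), cos_sq' θb]
      ring
    rw [key, Real.sqrt_sq (by positivity)]
  rw [Omega, hS, hT, hRx, hRbx, sin_sub]
  linear_combination (-4 * (p1 * p2) * sin θ ^ 2) * eb
end
end

section
/- Let rb1, rb2 ∈ ℝ³ be distinct unit vectors and let r1, r2 ∈ ℝ³ with ‖r1‖ ≤ 1 and ‖r2‖ ≤ 1. For vectors a, b ∈ ℝ³ and t ∈ ℝ define N(a, b, t) = 2·((1 − t)² + ‖a − t·b‖²) + 2·|(1 − t)² − ‖a − t·b‖²|. Then the family of inequalities N(rb1, rb2, t) ≤ N(r1, r2, t) for all t ≥ 0 holds if and only if ‖r1‖ = 1, ‖r2‖ = 1, and rb1·rb2 ≥ r1·r2. (This is the Bloch-vector form of the corollary of Alberti and Uhlmann's theorem: a CPTP map sending the qubit states with Bloch vectors r1, r2 to the distinct pure states with Bloch vectors rb1, rb2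 exists iff the sources are pure and the Bloch angle between the targets does not exceed the Bloch angle between the sources.) -/
noncomputable section

open Real

/-- `N(a, b, t) = 2·((1 − t)² + ‖a − t·b‖²) + 2·|(1 − t)² − ‖a − t·b‖²|`,
the squared trace norm `‖ρ_a − t·ρ_b‖_tr²` in Bloch-vector form. -/
def Ntr (a b : Fin 3 → ℝ) (t : ℝ) : ℝ :=
  2 * ((1 - t) ^ 2 + (norm3 (a - t • b)) ^ 2)
    + 2 * |(1 - t) ^ 2 - (norm3 (a - t • b)) ^ 2|

theorem norm3_eq_one_iff (v : Fin 3 → ℝ) : norm3 v = 1 ↔ dot3 v v = 1 :=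
  Real.sqrt_eq_one

theorem norm3_le_one_iff (v : Fin 3 → ℝ) : norm3 v ≤ 1 ↔ dot3 v v ≤ 1 := by
  simp [norm3, Real.sqrt_le_iff]

theorem norm3_sub_smul_sq (a b : Fin 3 → ℝ) (t : ℝ) :
    norm3 (a - t • b) ^ 2 = dot3 a a - 2 * t * dot3 a b + t ^ 2 * dot3 b b := by
  rw [norm3_sq]
  simp only [dot3, Pi.sub_apply, Pi.smul_apply, smul_eq_mul]
  ring

/-- Distinct unit vectors have inner product less than one. -/
theorem dot3_lt_one_of_ne {a b : Fin 3 → ℝ} (hne : a ≠ b) (ha : dot3 a a = 1)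
    (hb : dot3 b b = 1) : dot3 a b < 1 := by
  by_contra! h
  apply hne
  simp only [dot3] at ha hb h
  have hsq : (a 0 - b 0) ^ 2 + (a 1 - b 1) ^ 2 + (a 2 - b 2) ^ 2 ≤ 0 := by nlinarith
  have h0 := sq_nonneg (a 0 - b 0)
  have h1 := sq_nonneg (a 1 - b 1)
  have h2 := sq_nonneg (a 2 - b 2)
  ext i
  fin_cases i <;> refine sub_eq_zero.mp (pow_eq_zero_iff two_ne_zero |>.mp ?_) <;>
    simp only [Fin.zero_eta, Fin.mk_one, Fin.reduceFinMk] <;> linarith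

theorem Ntr_eq_max (a b : Fin 3 → ℝ) (t : ℝ) :
    Ntr a b t = 4 * max ((1 - t) ^ 2) (norm3 (a - t • b) ^ 2) := by
  unfold Ntr
  rcases le_total ((1 - t) ^ 2) (norm3 (a - t • b) ^ 2) with h | h
  · rw [max_eq_right h, abs_of_nonpos (by linarith)]
    ring
  · rw [max_eq_left h, abs_of_nonneg (by linarith)]
    ring

/-- A quadratic with nonpositive constant and leading coefficients that is nonnegative on
the positive half-line is linear. -/
theorem eq_zero_of_quadratic_nonneg {p k q : ℝ} (hp : p ≤ 0) (hq : q ≤ 0)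
    (h : ∀ t : ℝ, 0 < t → 0 ≤ p + t * k + t ^ 2 * q) : p = 0 ∧ q = 0 := by
  have hk : 0 < |k| + 1 := by positivity
  have hk' := le_abs_self k
  constructor
  · by_contra hne
    have hp' : 0 < -p := by
      have := lt_of_le_of_ne hp hne
      linarith
    have ht : 0 < -p / (|k| + 1) := div_pos hp' hk
    have hmul : -p / (|k| + 1) * (|k| + 1) = -p := div_mul_cancel₀ _ hk.ne'
    nlinarith [h _ ht, sq_nonneg (-p / (|k| + 1))]
  · by_contra hne
    have hq' : 0 < -q := by
      have := lt_of_le_of_ne hq hne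
      linarith
    have ht : 0 < (|k| + 1) / -q := div_pos hk hq'
    have hmul : (|k| + 1) / -q * -q = |k| + 1 := div_mul_cancel₀ _ hq'.ne'
    have hsq : ((|k| + 1) / -q) ^ 2 * q = -((|k| + 1) / -q * (|k| + 1)) := by
      linear_combination -((|k| + 1) / -q) * hmul
    nlinarith [h _ ht]

/-- for distinct unit target Bloch vectors `rb1 ≠ rb2` and source Bloch
vectors `r1, r2` with `‖r1‖ ≤ 1`, `‖r2‖ ≤ 1`, the Alberti–Uhlmann family of
inequalities `N(rb1, rb2, t) ≤ N(r1, r2, t)` for all `t ≥ 0` holds iff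
`‖r1‖ = 1`, `‖r2‖ = 1` and `rb1·rb2 ≥ r1·r2`. -/
theorem stmt_14 (rb1 rb2 r1 r2 : Fin 3 → ℝ)
    (hbne : rb1 ≠ rb2) (hb1 : norm3 rb1 = 1) (hb2 : norm3 rb2 = 1)
    (h1 : norm3 r1 ≤ 1) (h2 : norm3 r2 ≤ 1) :
    (∀ t : ℝ, 0 ≤ t → Ntr rb1 rb2 t ≤ Ntr r1 r2 t) ↔
      (norm3 r1 = 1 ∧ norm3 r2 = 1 ∧ dot3 r1 r2 ≤ dot3 rb1 rb2) := by
  rw [norm3_eq_one_iff] at hb1 hb2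
  rw [norm3_le_one_iff] at h1 h2
  rw [norm3_eq_one_iff, norm3_eq_one_iff]
  have hc := dot3_lt_one_of_ne hbne hb1 hb2
  simp only [Ntr_eq_max, norm3_sub_smul_sq, hb1, hb2]
  constructor
  · intro h
    have hquad : ∀ t : ℝ, 0 < t → 0 ≤ (dot3 r1 r1 - 1)
        + t * (2 * (dot3 rb1 rb2 - dot3 r1 r2)) + t ^ 2 * (dot3 r2 r2 - 1) := by
      intro t ht
      have hlt : (1 - t) ^ 2 < 1 - 2 * t * dot3 rb1 rb2 + t ^ 2 * 1 := by nlinarith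
      have hmax := le_of_mul_le_mul_left (h t ht.le) (by norm_num : (0 : ℝ) < 4)
      rcases le_max_iff.mp ((le_max_right _ _).trans hmax) with h' | h' <;> linarith
    obtain ⟨hp, hq⟩ := eq_zero_of_quadratic_nonneg (by linarith) (by linarith) hquad
    have hone := hquad 1 one_pos
    refine ⟨by linarith, by linarith, by linarith⟩
  · rintro ⟨hr1, hr2, hd⟩ t ht
    rw [hr1, hr2]
    gcongr
end
end

section
/- Let p1, p2 ∈ [0, 1] with p1 + p2 = 1, and let a, b ∈ ℝ³ with ‖a‖ ≤ 1 and ‖b‖ ≤ 1. For v = (v1, v2, v3) ∈ ℝ³ let ρ(v) be the 2×2 complex matrix (1/2)(I + v1·σx + v2·σy + v3·σz), where σx = [[0,1],[1,0]], σy = [[0,−i],[i,0]], σz = [[1,0],[0,−1]]. Then the matrix M = p1·ρ(a) − p2·ρ(b) is Hermitian, and the sum of the absolute values of its two eigenvalues equals max(|p1 − p2|, ‖p1·a − p2·b‖). (This computes the trace norm ‖p1·ρ1 − p2·ρ2‖_tr appearing in the Helstrom probability P_Helst = 1/2 + (1/2)‖p1·ρ1 − p2·ρ2‖_tr in Bloch-vector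 form, establishing the equivalence P_Helst = P_track.) -/
noncomputable section

open Real

/-- The qubit density matrix `ρ(v) = (1/2)(I + v1·σx + v2·σy + v3·σz)` with Bloch
vector `v`. -/
def rhoBloch (v : Fin 3 → ℝ) : Matrix (Fin 2) (Fin 2) ℂ :=
  (1 / 2 : ℂ) •
    ((1 : Matrix (Fin 2) (Fin 2) ℂ)
      + (v 0 : ℂ) • !![0, 1; 1, 0]
      + (v 1 : ℂ) • !![0, -Complex.I; Complex.I, 0]
      + (v 2 : ℂ) • !![1, 0; 0, -1])

theorem max_abs_add_abs_sub_eq (x y : ℝ) : max |x + y| |x - y| = |x| + |y| := by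
  rcases abs_cases x with hx | hx <;> rcases abs_cases y with hy | hy <;>
    rcases abs_cases (x + y) with hs | hs <;> rcases abs_cases (x - y) with hd | hd <;>
    rcases max_cases |x + y| |x - y| with hm | hm <;> linarith

/-- The trace norm of a Hermitian `2 × 2` matrix in terms of its trace and determinant. -/
theorem abs_eigenvalues_add_abs_eigenvalues {A : Matrix (Fin 2) (Fin 2) ℂ}
    (hA : A.IsHermitian) {t d : ℝ} (ht : A.trace = t) (hd : A.det = d) :
    |hA.eigenvalues 0| + |hA.eigenvalues 1| = max |t| √(t ^ 2 - 4 * d) := by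
  have ht' : hA.eigenvalues 0 + hA.eigenvalues 1 = t := by
    have : (t : ℂ) = (hA.eigenvalues 0 : ℂ) + (hA.eigenvalues 1 : ℂ) := by
      rw [← ht, hA.trace_eq_sum_eigenvalues, Fin.sum_univ_two]; rfl
    exact_mod_cast this.symm
  have hd' : hA.eigenvalues 0 * hA.eigenvalues 1 = d := by
    have : (d : ℂ) = (hA.eigenvalues 0 : ℂ) * (hA.eigenvalues 1 : ℂ) := by
      rw [← hd, hA.det_eq_prod_eigenvalues, Fin.prod_univ_two]; rfl
    exact_mod_cast this.symm
  rw [← max_abs_add_abs_sub_eq, ← ht', ← hd', ← Real.sqrt_sq_eq_abs (_ - _)]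
  ring_nf

theorem isHermitian_rhoBloch (v : Fin 3 → ℝ) : (rhoBloch v).IsHermitian := by
  ext i j
  fin_cases i <;> fin_cases j <;> simp [rhoBloch] <;> ring

theorem trace_smul_rhoBloch_sub (p q : ℝ) (a b : Fin 3 → ℝ) :
    (p • rhoBloch a - q • rhoBloch b).trace = ((p - q : ℝ) : ℂ) := by
  simp [rhoBloch, Matrix.trace_fin_two]

theorem det_smul_rhoBloch_sub (p q : ℝ) (a b : Fin 3 → ℝ) :
    (p • rhoBloch a - q • rhoBloch b).det =
      ((((p - q) ^ 2 - dot3 (p • a - q • b) (p • a - q • b)) / 4 : ℝ) : ℂ) := by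
  simp [rhoBloch, Matrix.det_fin_two, dot3]
  ring_nf
  simp only [Complex.I_sq]
  ring

/-- `M = p1·ρ(a) − p2·ρ(b)` is Hermitian and the sum of the absolute
values of its two eigenvalues equals `max(|p1 − p2|, ‖p1·a − p2·b‖)`. -/
theorem stmt_15 (p1 p2 : ℝ) (hp1 : p1 ∈ Set.Icc (0 : ℝ) 1)
    (hp2 : p2 ∈ Set.Icc (0 : ℝ) 1) (hp : p1 + p2 = 1)
    (a b : Fin 3 → ℝ) (ha : norm3 a ≤ 1) (hb : norm3 b ≤ 1) :
    (p1 • rhoBloch a - p2 • rhoBloch b).IsHermitian ∧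
    ∀ hM : (p1 • rhoBloch a - p2 • rhoBloch b).IsHermitian,
      |hM.eigenvalues 0| + |hM.eigenvalues 1|
        = max |p1 - p2| (norm3 (p1 • a - p2 • b)) := by
  refine ⟨((isHermitian_rhoBloch a).smul (IsSelfAdjoint.all p1)).sub
    ((isHermitian_rhoBloch b).smul (IsSelfAdjoint.all p2)), fun hM => ?_⟩
  rw [abs_eigenvalues_add_abs_eigenvalues hM (trace_smul_rhoBloch_sub p1 p2 a b)
    (det_smul_rhoBloch_sub p1 p2 a b), norm3]
  ring_nf
end
end

section
/- Let θb ∈ (0, π/2) and p ∈ (0, 1/2]. Set R1 = ((1−2p)·cos θb, 0, sin θb), R2 = ((1−2p)·cos θb, 0, −sin θb) (the Bloch vectors of the two pure states after the dephasing channel E(ς) = p·ZςZ + (1−p)·ς), and Rb1 = (1/2)·(cos θb, 0, sin θb), Rb2 = (1/2)·(cos θb, 0, −sin θb) (the original pure states weighted by equal priorities 1/2). Then Ω = 2·cos²θb·(1 − R² + 2p·sin²θb), where R² = (1−2p)²·cos²θb + sin²θb is the common squared length of the noisy Bloch vectors; in particular Ω > 0, so the optimal stabilization strategy is always the non-unitary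 procedure A. -/
noncomputable section

open Real

/-- The value of `Omega` for two mirror-symmetric pure states whose noisy Bloch vectors
have their first component contracted by `q`. -/
theorem omega_dephasing {c s q : ℝ} (hs : 0 ≤ s) (hc : 0 ≤ c) (hq : 0 ≤ q)
    (hq1 : q ≤ 1) (hsc : s ^ 2 + c ^ 2 = 1) :
    Omega ![q * c, 0, s] ![q * c, 0, -s]
        ((1 / 2 : ℝ) • ![c, 0, s]) ((1 / 2 : ℝ) • ![c, 0, -s])
      = 2 * c ^ 2 * (1 - q ^ 2 * c ^ 2 - q * s ^ 2) := by
  have hRx : norm3 (cross3 ![q * c, 0, s] ![q * c, 0, -s]) = 2 * q * c * s := by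
    rw [norm3, ← Real.sqrt_sq (show 0 ≤ 2 * q * c * s by positivity)]
    congr 1
    simp [dot3, cross3]
    ring
  have hRbx : norm3 (cross3 ((1 / 2 : ℝ) • ![c, 0, s]) ((1 / 2 : ℝ) • ![c, 0, -s]))
      = c * s / 2 := by
    rw [norm3, ← Real.sqrt_sq (show 0 ≤ c * s / 2 by positivity)]
    congr 1
    simp [dot3, cross3]
    ring
  have hRm : norm3 (![q * c, 0, s] - ![q * c, 0, -s]) = 2 * s := by
    rw [norm3, ← Real.sqrt_sq (show 0 ≤ 2 * s by positivity)]
    congr 1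
    simp [dot3]
    ring
  have hT : Tq ![q * c, 0, s] ![q * c, 0, -s]
      ((1 / 2 : ℝ) • ![c, 0, s]) ((1 / 2 : ℝ) • ![c, 0, -s])
      = (1 - q ^ 2 * c ^ 2) * c ^ 2 - (s ^ 2) ^ 2 := by
    simp [Tq, dot3]
    ring
  have hqc : 0 ≤ 1 - q ^ 2 * c ^ 2 :=
    sub_nonneg.2 (mul_le_one₀ (pow_le_one₀ hq hq1) (sq_nonneg c) (by nlinarith))
  have hS : Sq ![q * c, 0, s] ![q * c, 0, -s]
      ((1 / 2 : ℝ) • ![c, 0, s]) ((1 / 2 : ℝ) • ![c, 0, -s])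
      = (1 - q ^ 2 * c ^ 2) * c ^ 2 + (s ^ 2) ^ 2 := by
    rw [Sq, hT, hRx, hRbx, hRm, ← Real.sqrt_sq
      (show 0 ≤ (1 - q ^ 2 * c ^ 2) * c ^ 2 + (s ^ 2) ^ 2 by positivity)]
    congr 1
    ring
  rw [Omega, hS, hT, hRx, hRbx]
  ring

/-- for the dephasing-noise stabilization problem with
`θb ∈ (0, π/2)` and `p ∈ (0, 1/2]`, the indicator function equals
`Ω = 2·cos²θb·(1 − R² + 2p·sin²θb)` with `R² = (1−2p)²·cos²θb + sin²θb`;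
in particular `Ω > 0`. -/
theorem stmt_17 (θb p : ℝ)
    (hθb : θb ∈ Set.Ioo 0 (π / 2)) (hp : p ∈ Set.Ioc (0 : ℝ) (1 / 2)) :
    Omega ![(1 - 2 * p) * cos θb, 0, sin θb] ![(1 - 2 * p) * cos θb, 0, -sin θb]
        ((1 / 2 : ℝ) • ![cos θb, 0, sin θb]) ((1 / 2 : ℝ) • ![cos θb, 0, -sin θb])
      = 2 * cos θb ^ 2
          * (1 - ((1 - 2 * p) ^ 2 * cos θb ^ 2 + sin θb ^ 2) + 2 * p * sin θb ^ 2) ∧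
    0 < Omega ![(1 - 2 * p) * cos θb, 0, sin θb] ![(1 - 2 * p) * cos θb, 0, -sin θb]
        ((1 / 2 : ℝ) • ![cos θb, 0, sin θb]) ((1 / 2 : ℝ) • ![cos θb, 0, -sin θb]) := by
  obtain ⟨h0, h1⟩ := hθb
  obtain ⟨hp0, hp1⟩ := hp
  have hs : 0 < sin θb := sin_pos_of_pos_of_lt_pi h0 (by linarith)
  have hc : 0 < cos θb := cos_pos_of_mem_Ioo ⟨by linarith, h1⟩
  have hsc : sin θb ^ 2 + cos θb ^ 2 = 1 := sin_sq_add_cos_sq θb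
  rw [omega_dephasing hs.le hc.le (by linarith) (by linarith) hsc]
  have key : 1 - (1 - 2 * p) ^ 2 * cos θb ^ 2 - (1 - 2 * p) * sin θb ^ 2
      = 2 * p * (1 + (1 - 2 * p) * cos θb ^ 2) := by
    linear_combination (-(1 - 2 * p)) * hsc
  refine ⟨by ring, ?_⟩
  rw [key]
  have hq : 0 ≤ 1 - 2 * p := by linarith
  positivity
end
end

section
/- Let θ, θb ∈ (0, π/2] and R ∈ [0, 1]. Set R1 = R·(sin θ, 0, cos θ), R2 = R·(−sin θ, 0, cos θ) (mixed source states of equal Bloch length R separated by Bloch angle 2θ), and Rb1 = (1/2)·(sin θb, 0, cos θb), Rb2 = (1/2)·(−sin θb, 0, cos θb) (pure target states separated by Bloch angle 2θb, with equal priorities 1/2). Then Ω = 2·(cos²θb − R²·cos θ·cos θb·cos(θ − θb)). In particular, for θ = θb the indicator satisfies Ω = 2·cos²θ·(1 − R²) ≥ 0, with equality (for R < 1) if and only if θ = π/2. -/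
noncomputable section

open Real

/-- Norm of the cross product of two vectors of length `r` placed symmetrically about an axis. -/
theorem norm3_cross3_symmetric_pair (r a : ℝ) (hs : 0 ≤ sin a) (hc : 0 ≤ cos a) :
    norm3 (cross3 (r • ![sin a, 0, cos a]) (r • ![-sin a, 0, cos a]))
      = 2 * r ^ 2 * sin a * cos a := by
  rw [norm3, ← Real.sqrt_sq (by positivity : 0 ≤ 2 * r ^ 2 * sin a * cos a)]
  congr 1
  simp [dot3, cross3]
  ring

theorem norm3_sub_symmetric_pair_sq (r a : ℝ) :
    norm3 (r • ![sin a, 0, cos a] - r • ![-sin a, 0, cos a]) ^ 2 = 4 * r ^ 2 * sin a ^ 2 := by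
  rw [norm3, Real.sq_sqrt (dot3_self_nonneg _)]
  simp [dot3]
  ring

theorem Tq_symmetric_pairs (a b r : ℝ) :
    Tq (r • ![sin a, 0, cos a]) (r • ![-sin a, 0, cos a])
        ((1 / 2 : ℝ) • ![sin b, 0, cos b]) ((1 / 2 : ℝ) • ![-sin b, 0, cos b])
      = cos b ^ 2 - r ^ 2 * (sin a ^ 2 * sin b ^ 2 + cos a ^ 2 * cos b ^ 2) := by
  simp [Tq, dot3]
  ring

theorem Sq_symmetric_pairs (a b r : ℝ) (hsa : 0 ≤ sin a) (hca : 0 ≤ cos a)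
    (hsb : 0 ≤ sin b) (hcb : 0 ≤ cos b) (hr : r ^ 2 ≤ 1) :
    Sq (r • ![sin a, 0, cos a]) (r • ![-sin a, 0, cos a])
        ((1 / 2 : ℝ) • ![sin b, 0, cos b]) ((1 / 2 : ℝ) • ![-sin b, 0, cos b])
      = cos b ^ 2 * (1 - r ^ 2) + r ^ 2 * sin a ^ 2 := by
  have hr' : 0 ≤ 1 - r ^ 2 := sub_nonneg.2 hr
  rw [Sq, Tq_symmetric_pairs, norm3_cross3_symmetric_pair _ _ hsa hca,
    norm3_cross3_symmetric_pair _ _ hsb hcb, norm3_sub_symmetric_pair_sq,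
    ← Real.sqrt_sq (by positivity : 0 ≤ cos b ^ 2 * (1 - r ^ 2) + r ^ 2 * sin a ^ 2)]
  congr 1
  have ha : sin a ^ 2 = 1 - cos a ^ 2 := sin_sq a
  have hb : sin b ^ 2 = 1 - cos b ^ 2 := sin_sq b
  simp only [mul_pow, ha, hb]
  ring

theorem Omega_symmetric_pairs (a b r : ℝ) (hsa : 0 ≤ sin a) (hca : 0 ≤ cos a)
    (hsb : 0 ≤ sin b) (hcb : 0 ≤ cos b) (hr : r ^ 2 ≤ 1) :
    Omega (r • ![sin a, 0, cos a]) (r • ![-sin a, 0, cos a])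
        ((1 / 2 : ℝ) • ![sin b, 0, cos b]) ((1 / 2 : ℝ) • ![-sin b, 0, cos b])
      = 2 * (cos b ^ 2 - r ^ 2 * cos a * cos b * cos (a - b)) := by
  rw [Omega, Sq_symmetric_pairs a b r hsa hca hsb hcb hr, Tq_symmetric_pairs,
    norm3_cross3_symmetric_pair _ _ hsa hca, norm3_cross3_symmetric_pair _ _ hsb hcb, cos_sub]
  have ha : sin a ^ 2 = 1 - cos a ^ 2 := sin_sq a
  have hb : sin b ^ 2 = 1 - cos b ^ 2 := sin_sq b
  simp only [ha, hb]
  ring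

/-- for the purification problem with sources of Bloch length `R`
separated by angle `2θ` and pure targets separated by `2θb` (equal priorities `1/2`),
`Ω = 2·(cos²θb − R²·cos θ·cos θb·cos(θ − θb))`; in particular for `θb = θ` one has
`Ω = 2·cos²θ·(1 − R²) ≥ 0`, with equality (for `R < 1`) iff `θ = π/2`. -/
theorem stmt_18 (θ θb R : ℝ)
    (hθ : θ ∈ Set.Ioc 0 (π / 2)) (hθb : θb ∈ Set.Ioc 0 (π / 2))
    (hR : R ∈ Set.Icc (0 : ℝ) 1) :
    Omega (R • ![sin θ, 0, cos θ]) (R • ![-sin θ, 0, cos θ])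
        ((1 / 2 : ℝ) • ![sin θb, 0, cos θb]) ((1 / 2 : ℝ) • ![-sin θb, 0, cos θb])
      = 2 * (cos θb ^ 2 - R ^ 2 * cos θ * cos θb * cos (θ - θb)) ∧
    (θb = θ →
      Omega (R • ![sin θ, 0, cos θ]) (R • ![-sin θ, 0, cos θ])
          ((1 / 2 : ℝ) • ![sin θ, 0, cos θ]) ((1 / 2 : ℝ) • ![-sin θ, 0, cos θ])
        = 2 * cos θ ^ 2 * (1 - R ^ 2) ∧
      0 ≤ Omega (R • ![sin θ, 0, cos θ]) (R • ![-sin θ, 0, cos θ])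
          ((1 / 2 : ℝ) • ![sin θ, 0, cos θ]) ((1 / 2 : ℝ) • ![-sin θ, 0, cos θ]) ∧
      (R < 1 →
        (Omega (R • ![sin θ, 0, cos θ]) (R • ![-sin θ, 0, cos θ])
            ((1 / 2 : ℝ) • ![sin θ, 0, cos θ]) ((1 / 2 : ℝ) • ![-sin θ, 0, cos θ]) = 0
          ↔ θ = π / 2))) := by
  have sin_nonneg_of_mem {a : ℝ} (h : a ∈ Set.Ioc 0 (π / 2)) : 0 ≤ sin a :=
    sin_nonneg_of_nonneg_of_le_pi h.1.le (by linarith [h.2, pi_pos])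
  have cos_nonneg_of_mem {a : ℝ} (h : a ∈ Set.Ioc 0 (π / 2)) : 0 ≤ cos a :=
    cos_nonneg_of_neg_pi_div_two_le_of_le (by linarith [h.1, pi_pos]) h.2
  have hR2 : R ^ 2 ≤ 1 := pow_le_one₀ hR.1 hR.2
  have hs := sin_nonneg_of_mem hθ
  have hc := cos_nonneg_of_mem hθ
  refine ⟨Omega_symmetric_pairs θ θb R hs hc (sin_nonneg_of_mem hθb) (cos_nonneg_of_mem hθb) hR2,
    fun _ => ?_⟩
  have hΩ : Omega (R • ![sin θ, 0, cos θ]) (R • ![-sin θ, 0, cos θ])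
      ((1 / 2 : ℝ) • ![sin θ, 0, cos θ]) ((1 / 2 : ℝ) • ![-sin θ, 0, cos θ])
        = 2 * cos θ ^ 2 * (1 - R ^ 2) := by
    rw [Omega_symmetric_pairs θ θ R hs hc hs hc hR2, sub_self, cos_zero]
    ring
  rw [hΩ]
  refine ⟨rfl, mul_nonneg (by positivity) (sub_nonneg.2 hR2), fun hR1 => ⟨fun h => ?_, ?_⟩⟩
  · have hR2' : 1 - R ^ 2 ≠ 0 := (sub_pos.2 (pow_lt_one₀ hR.1 hR1 two_ne_zero)).ne'
    have hcos : cos θ = 0 := by simpa [hR2'] using h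
    by_contra hne
    exact (cos_pos_of_mem_Ioo ⟨by linarith [hθ.1, pi_pos], lt_of_le_of_ne hθ.2 hne⟩).ne' hcos
  · rintro rfl
    simp
end
end
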